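/- For any ordinal α and pointed systems (𝓜, M, ā) and (𝓝, N, b̄) of the same parameter size: Rank(M, ā, N, b̄) ≥ α in the game board MEF(𝓜, 𝓝) if and only if (𝓜, M, ā) ↔_α (𝓝, N, b̄). -/

import Mathlib

open FirstOrder Language

namespace Potentialist

/-- The underlying data of a potentialist system: a collection of worlds, each carrying a
first-order `L`-structure. -/
structure PreSys.{u, v, w, x} (L : FirstOrder.Language.{u, v}) where
  World : Type w
  Dom : World → Type x
  str : ∀ W, L.Structure (Dom W)

attribute [instance] PreSys.str

/-- A potentialist system: a collection of first-order `L`-structures together with a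
collection of `L`-embeddings between them, containing all identity embeddings and closed
under composition. -/
structure PotSys.{u, v, w, x} (L : FirstOrder.Language.{u, v})
    extends PreSys.{u, v, w, x} L where
  Emb : ∀ W W' : World, Set (Dom W ↪[L] Dom W')
  id_mem : ∀ W : World, Embedding.refl L (Dom W) ∈ Emb W W
  comp_mem : ∀ {W W' W'' : World} (f : Dom W ↪[L] Dom W') (g : Dom W' ↪[L] Dom W''),
    f ∈ Emb W W' → g ∈ Emb W' W'' → g.comp f ∈ Emb W W''

/-- Two tuples (in possibly different structures) satisfy the same atomic `L`-formulas. -/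
def AtomicEquiv.{u, v, y, z} (L : FirstOrder.Language.{u, v}) {M : Type y} {N : Type z}
    [L.Structure M] [L.Structure N] {n : ℕ} (a : Fin n → M) (b : Fin n → N) : Prop :=
  ∀ φ : L.Formula (Fin n), BoundedFormula.IsAtomic φ → (φ.Realize a ↔ φ.Realize b)

/-- The type of relations between pairs `(M, ā)` and `(N, b̄)` of equal parameter size. -/
abbrev BisimRel.{u, v, w, x, w', x'} {L : FirstOrder.Language.{u, v}}
    (S : PotSys.{u, v, w, x} L) (T : PotSys.{u, v, w', x'} L) :=
  ∀ (n : ℕ) (M : S.World), (Fin n → S.Dom M) → ∀ N : T.World, (Fin n → T.Dom N) → Prop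

/-- `R` is a bisimulation between the potentialist systems `S` and `T`: it is nonempty, and
whenever `R` relates `(M, ā)` to `(N, b̄)`: (B1) `ā` and `b̄` satisfy the same atomic formulas;
(B2) any extension of either tuple by one element can be matched on the other side;
(B3) any embedding on either side can be matched by an embedding on the other side. -/
def IsBisimulation.{u, v, w, x, w', x'} {L : FirstOrder.Language.{u, v}}
    (S : PotSys.{u, v, w, x} L) (T : PotSys.{u, v, w', x'} L) (R : BisimRel S T) : Prop :=
  (∃ n M a N b, R n M a N b) ∧
  ∀ (n : ℕ) (M : S.World) (a : Fin n → S.Dom M) (N : T.World) (b : Fin n → T.Dom N),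
    R n M a N b →
      AtomicEquiv L a b ∧
      (∀ c : S.Dom M, ∃ d : T.Dom N, R (n + 1) M (Fin.snoc a c) N (Fin.snoc b d)) ∧
      (∀ d : T.Dom N, ∃ c : S.Dom M, R (n + 1) M (Fin.snoc a c) N (Fin.snoc b d)) ∧
      (∀ (M' : S.World) (π : S.Dom M ↪[L] S.Dom M'), π ∈ S.Emb M M' →
        ∃ (N' : T.World) (ρ : T.Dom N ↪[L] T.Dom N'), ρ ∈ T.Emb N N' ∧
          R n M' (fun i => π (a i)) N' (fun i => ρ (b i))) ∧
      (∀ (N' : T.World) (ρ : T.Dom N ↪[L] T.Dom N'), ρ ∈ T.Emb N N' →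
        ∃ (M' : S.World) (π : S.Dom M ↪[L] S.Dom M'), π ∈ S.Emb M M' ∧
          R n M' (fun i => π (a i)) N' (fun i => ρ (b i)))

/-- Two pointed systems are bisimilar if some bisimulation relates them. -/
def Bisimilar.{u, v, w, x, w', x'} {L : FirstOrder.Language.{u, v}}
    (S : PotSys.{u, v, w, x} L) (T : PotSys.{u, v, w', x'} L)
    {n : ℕ} (M : S.World) (a : Fin n → S.Dom M) (N : T.World) (b : Fin n → T.Dom N) : Prop :=
  ∃ R : BisimRel S T, IsBisimulation S T R ∧ R n M a N b

/-- A relation is bitotal if every pair on the left is related to some pair on the right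
and vice versa. -/
def Bitotal.{u, v, w, x, w', x'} {L : FirstOrder.Language.{u, v}}
    (S : PotSys.{u, v, w, x} L) (T : PotSys.{u, v, w', x'} L) (R : BisimRel S T) : Prop :=
  (∀ (n : ℕ) (M : S.World) (a : Fin n → S.Dom M), ∃ N b, R n M a N b) ∧
  (∀ (n : ℕ) (N : T.World) (b : Fin n → T.Dom N), ∃ M a, R n M a N b)

/-- Two potentialist systems are bitotally bisimilar if there is a bitotal bisimulation
between them. -/
def BitotallyBisimilar.{u, v, w, x, w', x'} {L : FirstOrder.Language.{u, v}}
    (S : PotSys.{u, v, w, x} L) (T : PotSys.{u, v, w', x'} L) : Prop :=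
  ∃ R : BisimRel S T, IsBisimulation S T R ∧ Bitotal S T R

/-- An iso-bisimulation between potentialist systems: a nonempty relation between worlds
together with a system of isomorphisms, such that embeddings on either side can be matched
by embeddings on the other side, commuting with the isomorphisms. -/
structure IsoBisim.{u, v, w, x, w', x'} {L : FirstOrder.Language.{u, v}}
    (S : PotSys.{u, v, w, x} L) (T : PotSys.{u, v, w', x'} L) where
  rel : S.World → T.World → Prop
  nonempty : ∃ M N, rel M N
  iso : ∀ {M : S.World} {N : T.World}, rel M N → (S.Dom M ≃[L] T.Dom N)
  forth : ∀ {M : S.World} {N : T.World} (h : rel M N) (M' : S.World)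
      (π : S.Dom M ↪[L] S.Dom M'), π ∈ S.Emb M M' →
      ∃ (N' : T.World) (ρ : T.Dom N ↪[L] T.Dom N') (_ : ρ ∈ T.Emb N N') (h' : rel M' N'),
        ∀ y : S.Dom M, iso h' (π y) = ρ (iso h y)
  back : ∀ {M : S.World} {N : T.World} (h : rel M N) (N' : T.World)
      (ρ : T.Dom N ↪[L] T.Dom N'), ρ ∈ T.Emb N N' →
      ∃ (M' : S.World) (π : S.Dom M ↪[L] S.Dom M') (_ : π ∈ S.Emb M M') (h' : rel M' N'),
        ∀ y : S.Dom M, iso h' (π y) = ρ (iso h y)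

/-- An iso-bisimulation is bitotal if every world on either side takes part in the relation. -/
def IsoBisim.Bitotal.{u, v, w, x, w', x'} {L : FirstOrder.Language.{u, v}}
    {S : PotSys.{u, v, w, x} L} {T : PotSys.{u, v, w', x'} L} (I : IsoBisim S T) : Prop :=
  (∀ M : S.World, ∃ N, I.rel M N) ∧ (∀ N : T.World, ∃ M, I.rel M N)


/-- The type of ordinal-indexed families of relations between pairs `(M, ā)` and `(N, b̄)`. -/
abbrev AlphaBisimRel.{r, u, v, w, x, w', x'} {L : FirstOrder.Language.{u, v}}
    (S : PotSys.{u, v, w, x} L) (T : PotSys.{u, v, w', x'} L) :=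
  Ordinal.{r} → ∀ (n : ℕ) (M : S.World), (Fin n → S.Dom M) → ∀ N : T.World, (Fin n → T.Dom N) → Prop

/-- `R` is an `α`-bisimulation between `S` and `T`: a family of nonempty relations `R β`
for `β ≤ α` such that whenever `R β` relates `(M, ā)` to `(N, b̄)`: (αB1) `ā` and `b̄` satisfy
the same atomic formulas; (αB2) for every `γ < β`, any one-element extension of either tuple
can be matched by the other at level `γ`; (αB3) for every `γ < β`, any embedding on either
side can be matched by one on the other side at level `γ`. -/
def IsAlphaBisimulation.{r, u, v, w, x, w', x'} {L : FirstOrder.Language.{u, v}}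
    (S : PotSys.{u, v, w, x} L) (T : PotSys.{u, v, w', x'} L) (α : Ordinal.{r})
    (R : AlphaBisimRel.{r} S T) : Prop :=
  (∀ β ≤ α, ∃ n M a N b, R β n M a N b) ∧
  ∀ β ≤ α, ∀ (n : ℕ) (M : S.World) (a : Fin n → S.Dom M) (N : T.World) (b : Fin n → T.Dom N),
    R β n M a N b →
      AtomicEquiv L a b ∧
      (∀ γ < β, ∀ c : S.Dom M, ∃ d : T.Dom N,
        R γ (n + 1) M (Fin.snoc a c) N (Fin.snoc b d)) ∧
      (∀ γ < β, ∀ d : T.Dom N, ∃ c : S.Dom M,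
        R γ (n + 1) M (Fin.snoc a c) N (Fin.snoc b d)) ∧
      (∀ γ < β, ∀ (M' : S.World) (π : S.Dom M ↪[L] S.Dom M'), π ∈ S.Emb M M' →
        ∃ (N' : T.World) (ρ : T.Dom N ↪[L] T.Dom N'), ρ ∈ T.Emb N N' ∧
          R γ n M' (fun i => π (a i)) N' (fun i => ρ (b i))) ∧
      (∀ γ < β, ∀ (N' : T.World) (ρ : T.Dom N ↪[L] T.Dom N'), ρ ∈ T.Emb N N' →
        ∃ (M' : S.World) (π : S.Dom M ↪[L] S.Dom M'), π ∈ S.Emb M M' ∧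
          R γ n M' (fun i => π (a i)) N' (fun i => ρ (b i)))

/-- Two pointed systems are `α`-bisimilar if some `α`-bisimulation relates them at level `α`. -/
def AlphaBisimilar.{r, u, v, w, x, w', x'} {L : FirstOrder.Language.{u, v}}
    (S : PotSys.{u, v, w, x} L) (T : PotSys.{u, v, w', x'} L) (α : Ordinal.{r})
    {n : ℕ} (M : S.World) (a : Fin n → S.Dom M) (N : T.World) (b : Fin n → T.Dom N) : Prop :=
  ∃ R : AlphaBisimRel.{r} S T, IsAlphaBisimulation S T α R ∧ R α n M a N b

/-- `RankGE S T α n M a N b` expresses that the position `(M, ā, N, b̄)` of the modal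
Ehrenfeucht–Fraïssé game board between `S` and `T` has rank at least `α`: the tuples satisfy
the same atomic formulas, and for every `β < α`, every move of Abelard from this position
(choosing an element on either side, or an embedding on either side) can be answered by
Eloise reaching a position of rank at least `β`. -/
def RankGE.{r, u, v, w, x, w', x'} {L : FirstOrder.Language.{u, v}}
    (S : PotSys.{u, v, w, x} L) (T : PotSys.{u, v, w', x'} L) (α : Ordinal.{r})
    (n : ℕ) (M : S.World) (a : Fin n → S.Dom M) (N : T.World) (b : Fin n → T.Dom N) : Prop :=
  AtomicEquiv L a b ∧
  ∀ β < α,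
    (∀ c : S.Dom M, ∃ d : T.Dom N,
      RankGE S T β (n + 1) M (Fin.snoc a c) N (Fin.snoc b d)) ∧
    (∀ d : T.Dom N, ∃ c : S.Dom M,
      RankGE S T β (n + 1) M (Fin.snoc a c) N (Fin.snoc b d)) ∧
    (∀ (M' : S.World) (π : S.Dom M ↪[L] S.Dom M'), π ∈ S.Emb M M' →
      ∃ (N' : T.World) (ρ : T.Dom N ↪[L] T.Dom N'), ρ ∈ T.Emb N N' ∧
        RankGE S T β n M' (fun i => π (a i)) N' (fun i => ρ (b i))) ∧
    (∀ (N' : T.World) (ρ : T.Dom N ↪[L] T.Dom N'), ρ ∈ T.Emb N N' →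
      ∃ (M' : S.World) (π : S.Dom M ↪[L] S.Dom M'), π ∈ S.Emb M M' ∧
        RankGE S T β n M' (fun i => π (a i)) N' (fun i => ρ (b i)))
termination_by α


/-- Rank lower bounds are downward closed in the ordinal. -/
theorem RankGE.mono.{r, u, v, w, x, w', x'} {L : FirstOrder.Language.{u, v}}
    {S : PotSys.{u, v, w, x} L} {T : PotSys.{u, v, w', x'} L} {α β : Ordinal.{r}} (hβ : β ≤ α)
    {n : ℕ} {M : S.World} {a : Fin n → S.Dom M} {N : T.World} {b : Fin n → T.Dom N}
    (h : RankGE S T α n M a N b) : RankGE S T β n M a N b := by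
  rw [RankGE] at h ⊢
  exact ⟨h.1, fun γ hγ => h.2 γ (hγ.trans_le hβ)⟩

/-- If some position has rank at least `α`, then the relations `RankGE S T β` form an
`α`-bisimulation. -/
theorem RankGE.isAlphaBisimulation.{r, u, v, w, x, w', x'} {L : FirstOrder.Language.{u, v}}
    {S : PotSys.{u, v, w, x} L} {T : PotSys.{u, v, w', x'} L} {α : Ordinal.{r}}
    {n : ℕ} {M : S.World} {a : Fin n → S.Dom M} {N : T.World} {b : Fin n → T.Dom N}
    (h : RankGE S T α n M a N b) : IsAlphaBisimulation S T α (RankGE S T) := by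
  refine ⟨fun β hβ => ⟨n, M, a, N, b, h.mono hβ⟩, fun β _ n M a N b hR => ?_⟩
  rw [RankGE] at hR
  exact ⟨hR.1, fun γ hγ => (hR.2 γ hγ).1, fun γ hγ => (hR.2 γ hγ).2.1,
    fun γ hγ => (hR.2 γ hγ).2.2.1, fun γ hγ => (hR.2 γ hγ).2.2.2⟩

/-- Positions related at level `β ≤ α` by an `α`-bisimulation have rank at least `β`. -/
theorem IsAlphaBisimulation.rankGE.{r, u, v, w, x, w', x'} {L : FirstOrder.Language.{u, v}}
    {S : PotSys.{u, v, w, x} L} {T : PotSys.{u, v, w', x'} L} {α : Ordinal.{r}}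
    {R : AlphaBisimRel.{r} S T} (hR : IsAlphaBisimulation S T α R) {β : Ordinal.{r}} (hβ : β ≤ α)
    {n : ℕ} {M : S.World} {a : Fin n → S.Dom M} {N : T.World} {b : Fin n → T.Dom N}
    (h : R β n M a N b) : RankGE S T β n M a N b := by
  induction β using WellFoundedLT.induction generalizing n M N with
  | ind β ih =>
    obtain ⟨hat, hforth, hback, hembForth, hembBack⟩ := hR.2 β hβ n M a N b h
    rw [RankGE]
    refine ⟨hat, fun γ hγ => ?_⟩
    have hγα := hγ.le.trans hβ
    refine ⟨fun c => ?_, fun d => ?_, fun M' π hπ => ?_, fun N' ρ hρ => ?_⟩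
    · obtain ⟨d, hd⟩ := hforth γ hγ c
      exact ⟨d, ih γ hγ hγα hd⟩
    · obtain ⟨c, hc⟩ := hback γ hγ d
      exact ⟨c, ih γ hγ hγα hc⟩
    · obtain ⟨N', ρ, hρ, hr⟩ := hembForth γ hγ M' π hπ
      exact ⟨N', ρ, hρ, ih γ hγ hγα hr⟩
    · obtain ⟨M', π, hπ, hr⟩ := hembBack γ hγ N' ρ hρ
      exact ⟨M', π, hπ, ih γ hγ hγα hr⟩

/-- a position of the modal Ehrenfeucht–Fraïssé game board has rank at least
`α` iff the corresponding pointed systems are `α`-bisimilar. -/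
theorem rankGE_iff_alphaBisimilar.{r, u, v, w, x, w', x'}
    {L : FirstOrder.Language.{u, v}}
    (S : PotSys.{u, v, w, x} L) (T : PotSys.{u, v, w', x'} L) (α : Ordinal.{r})
    {n : ℕ} (M : S.World) (a : Fin n → S.Dom M) (N : T.World) (b : Fin n → T.Dom N) :
    RankGE S T α n M a N b ↔ AlphaBisimilar S T α M a N b :=
  ⟨fun h => ⟨RankGE S T, h.isAlphaBisimulation, h⟩, fun ⟨_, hR, h⟩ => hR.rankGE le_rfl h⟩

end Potentialist
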